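/- Let M be a prime and q a power of M. Let α ∈ GL(n, F_q) and suppose F_q^n, viewed as an F_q[X]-module with X acting as α, is isomorphic to ⊕_{i=1}^{l} ⊕_{j} F_q[X]/(f_i^{λ_{i,j}}), where f_1,…,f_l are distinct monic irreducible polynomials ≠ X and λ_{f_i} = (λ_{i,1} ≥ λ_{i,2} ≥ …) is a partition for each i. Then X^M = α has a solution in GL(n, F_q) if and only if each partition λ_{f_i} lies in the image of the map Θ_M on the set of partitions of |λ_{f_i}| (where |λ_{f_i}| = Σ_j λ_{i,j}). -/

import Mathlib

open Polynomial DirectSum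

/-- The map `Θ_M` on partitions, described on the underlying multiset of parts: each part `p`
is replaced by `p % M` copies of `⌈p/M⌉` and `M − p % M` copies of `⌊p/M⌋`, and zero parts
are discarded (multisets account for rearrangement into non-increasing order). -/
def thetaMul (M : ℕ) (s : Multiset ℕ) : Multiset ℕ :=
  (s.bind fun p => Multiset.replicate (p % M) (p / M + 1) +
    Multiset.replicate (M - p % M) (p / M)).filter (0 < ·)

theorem sum_map_min_filter_pos (t : Multiset ℕ) (k : ℕ) :
    ((t.filter (0 < ·)).map (min k)).sum = (t.map (min k)).sum := by
  induction t using Multiset.induction_on with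
  | empty => simp
  | cons a t ih =>
    rcases Nat.eq_zero_or_pos a with rfl | h
    · simp [ih]
    · simp [h, ih]

theorem sum_filter_pos (t : Multiset ℕ) : (t.filter (0 < ·)).sum = t.sum := by
  induction t using Multiset.induction_on with
  | empty => simp
  | cons a t ih =>
    rcases Nat.eq_zero_or_pos a with rfl | h
    · simp [ih]
    · simp [h, ih]

theorem mod_mul_min_add {M : ℕ} (hM : 0 < M) (p k : ℕ) :
    p % M * min k (p / M + 1) + (M - p % M) * min k (p / M) = min (M * k) p := by
  obtain ⟨t, ht⟩ := Nat.exists_eq_add_of_le (Nat.mod_lt p hM).le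
  have hp := Nat.div_add_mod p M
  generalize p % M = r at *
  generalize p / M = d at *
  have h : M - r = t := by omega
  rw [h, ← hp]
  rcases le_or_gt k d with hk | hk
  · rw [min_eq_left hk, min_eq_left (by omega), min_eq_left, ht]
    · ring
    · exact (Nat.mul_le_mul_left M hk).trans (Nat.le_add_right _ _)
  · rw [min_eq_right hk.le, min_eq_right hk, min_eq_right, ht]
    · ring
    · have : M * (d + 1) ≤ M * k := Nat.mul_le_mul_left M hk
      rw [mul_add] at this
      omega

theorem sum_map_min_thetaMul {M : ℕ} (hM : 0 < M) (s : Multiset ℕ) (k : ℕ) :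
    ((thetaMul M s).map (min k)).sum = (s.map (min (M * k))).sum := by
  rw [thetaMul, sum_map_min_filter_pos, Multiset.map_bind, Multiset.sum_bind]
  simp [mod_mul_min_add hM]

theorem sum_thetaMul {M : ℕ} (hM : 0 < M) (s : Multiset ℕ) : (thetaMul M s).sum = s.sum := by
  rw [thetaMul, sum_filter_pos, Multiset.sum_bind]
  conv_rhs => rw [← Multiset.map_id s]
  congr 1
  refine Multiset.map_congr rfl fun p _ => ?_
  simp only [Multiset.sum_add, Multiset.sum_replicate, smul_eq_mul, id]
  have h := (Nat.mod_lt p hM).le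
  obtain ⟨t, ht⟩ := Nat.exists_eq_add_of_le h
  have hp := Nat.div_add_mod p M
  generalize p % M = r at *
  generalize p / M = d at *
  have h : M - r = t := by omega
  rw [h, ← hp, ht]
  ring

theorem sum_map_min_add_count (t : Multiset ℕ) (k : ℕ) :
    (t.map (min k)).sum + (t.map (min (k + 2))).sum + t.count (k + 1) =
      2 * (t.map (min (k + 1))).sum := by
  induction t using Multiset.induction_on with
  | empty => simp
  | cons a t ih =>
    simp only [Multiset.map_cons, Multiset.sum_cons, Multiset.count_cons]
    split_ifs <;> omega

theorem eq_of_sum_map_min_eq {s t : Multiset ℕ} (hs : ∀ p ∈ s, 0 < p) (ht : ∀ p ∈ t, 0 < p)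
    (h : ∀ k, (s.map (min k)).sum = (t.map (min k)).sum) : s = t := by
  ext a
  rcases a with _ | k
  · rw [Multiset.count_eq_zero_of_notMem fun h0 => (hs 0 h0).false,
      Multiset.count_eq_zero_of_notMem fun h0 => (ht 0 h0).false]
  · have h1 := sum_map_min_add_count s k
    have h2 := sum_map_min_add_count t k
    rw [h, h, h] at h1
    omega

theorem map_range_add_div {M : ℕ} (hM : 0 < M) (p : ℕ) :
    (Multiset.range M).map (fun a => (p + a) / M) =
      Multiset.replicate (p % M) (p / M + 1) + Multiset.replicate (M - p % M) (p / M) := by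
  have hr := Nat.mod_lt p hM
  have hp := Nat.div_add_mod p M
  generalize p % M = r at *
  generalize p / M = d at *
  obtain ⟨t, rfl⟩ := Nat.exists_eq_add_of_le' hr.le
  rw [Multiset.range_add, Multiset.map_add, Multiset.map_map, add_comm, Nat.add_sub_cancel]
  congr 1
  · rw [Multiset.eq_replicate]
    refine ⟨by simp, fun b hb => ?_⟩
    obtain ⟨a, ha, rfl⟩ := Multiset.mem_map.1 hb
    rw [Multiset.mem_range] at ha
    rw [Function.comp, ← hp, show (t + r) * d + r + (t + a) = (t + r) * (d + 1) + a by ring,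
      Nat.mul_add_div hM, Nat.div_eq_of_lt (by omega), add_zero]
  · rw [Multiset.eq_replicate]
    refine ⟨by simp, fun b hb => ?_⟩
    obtain ⟨a, ha, rfl⟩ := Multiset.mem_map.1 hb
    rw [Multiset.mem_range] at ha
    rw [← hp, add_assoc, Nat.mul_add_div hM, Nat.div_eq_of_lt (by omega), add_zero]

theorem sum_range_add_div {M : ℕ} (hM : 0 < M) (p : ℕ) :
    ∑ a : Fin M, (p + a) / M = p := by
  rw [Fin.sum_univ_eq_sum_range (fun a => (p + a) / M)]
  have h := sum_thetaMul hM {p}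
  rw [thetaMul, sum_filter_pos, Multiset.singleton_bind, ← map_range_add_div hM,
    Multiset.sum_singleton] at h
  exact h

theorem exists_equiv_of_map_univ_eq {A B γ : Type*} [Fintype A] [Fintype B] {k : A → γ} {l : B → γ}
    (h : Finset.univ.val.map k = Finset.univ.val.map l) : ∃ e : A ≃ B, ∀ a, l (e a) = k a := by
  classical
  have key (v : γ) : Nonempty ({a // k a = v} ≃ {b // l b = v}) := by
    refine ⟨Fintype.equivOfCardEq ?_⟩
    have := congrArg (Multiset.count v) h
    rw [Multiset.count_map, Multiset.count_map] at this
    simp only [Fintype.card_subtype, Finset.card_def, Finset.filter_val, eq_comm (b := v)]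
    exact this
  exact ⟨Equiv.ofFiberEquiv fun v => (key v).some, fun a => Equiv.ofFiberEquiv_map _ a⟩

theorem map_univ_subtype_val {A γ : Type*} [Fintype A] (p : γ → Prop) [DecidablePred p] (k : A → γ) :
    (Finset.univ : Finset {a // p (k a)}).val.map (fun a => k a.1) =
      (Finset.univ.val.map k).filter p := by
  classical
  rw [Multiset.filter_map]
  change _ = Multiset.map k ((Finset.univ : Finset A).filter (p ∘ k)).val
  rw [← Finset.subtype_map, Finset.map_val, Multiset.map_map, Finset.subtype_univ]
  rfl

section
variable {R : Type*} [CommRing R]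

theorem nonempty_equiv_pi_of_subsingleton {A : Type*} (p : A → Prop) (N : A → Type*)
    [∀ a, AddCommGroup (N a)] [∀ a, Module R (N a)] (h : ∀ a, ¬ p a → Subsingleton (N a)) :
    Nonempty ((Π a : {a // p a}, N a) ≃ₗ[R] Π a, N a) := by
  classical
  let φ : (Π a, N a) →ₗ[R] Π a : {a // p a}, N a := LinearMap.pi fun a => LinearMap.proj a.1
  refine ⟨(LinearEquiv.ofBijective φ ⟨fun x y hxy => ?_, fun y => ?_⟩).symm⟩
  · ext a
    by_cases ha : p a
    · exact congrFun hxy ⟨a, ha⟩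
    · exact (h a ha).elim _ _
  · refine ⟨fun a => if ha : p a then y ⟨a, ha⟩ else 0, ?_⟩
    ext a
    simp [φ, a.2]

theorem nonempty_pi_quotient_pow_equiv {A B : Type*} [Fintype A] [Fintype B] (f : R)
    {k : A → ℕ} {l : B → ℕ}
    (h : (Finset.univ.val.map k).filter (0 < ·) = Finset.univ.val.map l) :
    Nonempty ((Π a, R ⧸ Ideal.span {f ^ k a}) ≃ₗ[R] Π b, R ⧸ Ideal.span {f ^ l b}) := by
  rw [← map_univ_subtype_val] at h
  obtain ⟨e, he⟩ := exists_equiv_of_map_univ_eq h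
  obtain ⟨φ⟩ := nonempty_equiv_pi_of_subsingleton (R := R) (fun a => 0 < k a)
    (fun a => R ⧸ Ideal.span {f ^ k a}) fun a ha => by
      rw [Ideal.Quotient.subsingleton_iff, Nat.eq_zero_of_not_pos ha, pow_zero,
        Ideal.span_singleton_one]
  refine ⟨φ.symm ≪≫ₗ (LinearEquiv.piCongrRight fun a => ?_) ≪≫ₗ
    LinearEquiv.piCongrLeft R (fun b => R ⧸ Ideal.span {f ^ l b}) e⟩
  exact Submodule.quotEquivOfEq _ _ (by rw [he a])

theorem card_torsion_congr {N N' : Type*} [AddCommMonoid N] [Module R N] [AddCommMonoid N']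
    [Module R N'] (e : N ≃ₗ[R] N') (h : R) :
    Nat.card {v : N // h • v = 0} = Nat.card {v : N' // h • v = 0} :=
  Nat.card_congr (e.toEquiv.subtypeEquiv fun v => by
    rw [LinearEquiv.coe_toEquiv, ← map_smul, LinearEquiv.map_eq_zero_iff])

theorem card_torsion_pi {ι : Type*} [Fintype ι] (N : ι → Type*) [∀ i, AddCommMonoid (N i)]
    [∀ i, Module R (N i)] (h : R) :
    Nat.card {v : Π i, N i // h • v = 0} = ∏ i, Nat.card {v : N i // h • v = 0} := by
  rw [← Nat.card_pi]
  exact Nat.card_congr ((Equiv.subtypeEquivRight fun v => funext_iff).trans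
    (Equiv.subtypePiEquivPi (p := fun i (v : N i) => h • v = 0)))

theorem card_torsion_directSum {ι : Type*} [Fintype ι] (N : ι → Type*) [∀ i, AddCommMonoid (N i)]
    [∀ i, Module R (N i)] (h : R) :
    Nat.card {v : ⨁ i, N i // h • v = 0} = ∏ i, Nat.card {v : N i // h • v = 0} := by
  classical
  rw [← card_torsion_pi]
  exact card_torsion_congr (DirectSum.linearEquivFunOnFintype R ι N) h

theorem card_torsion_quotient_of_isCoprime {f h : R} (hc : IsCoprime f h) :
    Nat.card {v : R ⧸ Ideal.span {f} // h • v = 0} = 1 := by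
  refine Nat.card_eq_one_iff_exists.2 ⟨⟨0, smul_zero _⟩, fun ⟨v, hv⟩ => Subtype.ext ?_⟩
  obtain ⟨x, rfl⟩ := Ideal.Quotient.mk_surjective v
  change Ideal.Quotient.mk _ (h * x) = 0 at hv
  change Ideal.Quotient.mk _ x = 0
  rw [Ideal.Quotient.eq_zero_iff_mem, Ideal.mem_span_singleton] at hv ⊢
  exact hc.dvd_of_dvd_mul_left hv

theorem card_torsion_mul_card_quotient [IsDomain R] {f : R} (hf : f ≠ 0) (e k : ℕ) :
    Nat.card {v : R ⧸ Ideal.span {f ^ e} // f ^ k • v = 0} *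
      Nat.card (R ⧸ Ideal.span {f ^ (e - k)}) = Nat.card (R ⧸ Ideal.span {f ^ e}) := by
  let φ : (R ⧸ Ideal.span {f ^ e}) →+* (R ⧸ Ideal.span {f ^ (e - k)}) :=
    Ideal.Quotient.factor (Ideal.span_singleton_le_span_singleton.2 (pow_dvd_pow f (Nat.sub_le e k)))
  have hφ : Function.Surjective φ := Ideal.Quotient.factor_surjective _
  rw [AddSubgroup.card_eq_card_quotient_mul_card_addSubgroup φ.toAddMonoidHom.ker,
    Nat.card_congr (QuotientAddGroup.quotientKerEquivOfSurjective φ.toAddMonoidHom hφ).toEquiv,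
    mul_comm]
  congr 1
  refine Nat.card_congr (Equiv.subtypeEquivRight fun v => ?_)
  obtain ⟨x, rfl⟩ := Ideal.Quotient.mk_surjective v
  change Ideal.Quotient.mk _ (f ^ k * x) = 0 ↔ Ideal.Quotient.mk _ x = 0
  rw [Ideal.Quotient.eq_zero_iff_mem, Ideal.Quotient.eq_zero_iff_mem, Ideal.mem_span_singleton,
    Ideal.mem_span_singleton]
  rcases le_total e k with h | h
  · rw [Nat.sub_eq_zero_of_le h, pow_zero]
    exact iff_of_true ((pow_dvd_pow f h).mul_right x) (one_dvd x)
  · obtain ⟨d, rfl⟩ := Nat.exists_eq_add_of_le h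
    rw [Nat.add_sub_cancel_left, pow_add, mul_dvd_mul_iff_left (pow_ne_zero k hf)]

end

section
variable {F : Type*} [Field F] [Fintype F]

theorem natCard_quotient_span {f : F[X]} (hf : f ≠ 0) :
    Nat.card (F[X] ⧸ Ideal.span {f}) = Fintype.card F ^ f.natDegree := by
  have : Module.Finite F (F[X] ⧸ Ideal.span {f}) := (AdjoinRoot.powerBasis hf).finite
  rw [Module.natCard_eq_pow_finrank (K := F), finrank_quotient_span_eq_natDegree,
    Nat.card_eq_fintype_card]

theorem finite_quotient_span {f : F[X]} (hf : f ≠ 0) : Finite (F[X] ⧸ Ideal.span {f}) := by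
  have : Module.Finite F (F[X] ⧸ Ideal.span {f}) := (AdjoinRoot.powerBasis hf).finite
  exact Module.finite_of_finite F

theorem card_torsion_quotient_pow {f : F[X]} (hf : f ≠ 0) (e k : ℕ) :
    Nat.card {v : F[X] ⧸ Ideal.span {f ^ e} // f ^ k • v = 0} =
      Fintype.card F ^ (f.natDegree * min k e) := by
  have h := card_torsion_mul_card_quotient hf e k
  rw [natCard_quotient_span (pow_ne_zero _ hf), natCard_quotient_span (pow_ne_zero _ hf),
    natDegree_pow, natDegree_pow] at h
  refine Nat.eq_of_mul_eq_mul_right (pow_pos (Fintype.card_pos (α := F)) ((e - k) * f.natDegree)) ?_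
  rw [h, ← pow_add, mul_comm f.natDegree, ← add_mul]
  congr 2
  omega

end

section
variable {F : Type*} [Field F]

/-- Multiplication by `X` on the `F[X]`-module `N` has an `F`-linear `M`-th root. -/
def HasXRoot (F : Type*) [Field F] (M : ℕ) (N : Type*) [AddCommMonoid N] [Module F[X] N] : Prop :=
  ∃ b : N →+ N, (∀ (c : F) x, b ((C c : F[X]) • x) = (C c : F[X]) • b x) ∧
    ∀ x, b^[M] x = (X : F[X]) • x

/-- An additive equivalence that is semilinear along `X ↦ X ^ M` exhibits a root of `X`. -/
theorem HasXRoot.of_addEquiv_expand {M : ℕ} {N N' : Type*} [AddCommMonoid N] [Module F[X] N]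
    [AddCommMonoid N'] [Module F[X] N'] (e : N ≃+ N')
    (he : ∀ (h : F[X]) x, e (h • x) = expand F M h • e x) : HasXRoot F M N := by
  refine ⟨e.symm.toAddMonoidHom.comp ((DistribSMul.toAddMonoidHom N' (X : F[X])).comp
    e.toAddMonoidHom), fun c x => e.injective ?_, fun x => e.injective ?_⟩
  · change e (e.symm ((X : F[X]) • e ((C c : F[X]) • x))) =
      e ((C c : F[X]) • e.symm ((X : F[X]) • e x))
    rw [e.apply_symm_apply, he, he, e.apply_symm_apply, expand_C, smul_comm]
  · have key (m : ℕ) : e ((e.symm.toAddMonoidHom.comp ((DistribSMul.toAddMonoidHom N'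
        (X : F[X])).comp e.toAddMonoidHom))^[m] x) = (X ^ m : F[X]) • e x := by
      induction m with
      | zero => simp
      | succ m ih =>
        rw [Function.iterate_succ_apply', pow_succ', mul_smul, ← ih]
        exact e.apply_symm_apply _
    rw [key, he, expand_X]

theorem HasXRoot.congr {M : ℕ} {N N' : Type*} [AddCommMonoid N] [Module F[X] N]
    [AddCommMonoid N'] [Module F[X] N'] (e : N ≃ₗ[F[X]] N') (hN : HasXRoot F M N) :
    HasXRoot F M N' := by
  obtain ⟨b, hb, hX⟩ := hN
  refine ⟨e.toLinearMap.toAddMonoidHom.comp (b.comp e.symm.toLinearMap.toAddMonoidHom),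
    fun c x => by simp [hb], fun x => ?_⟩
  have key (m : ℕ) : (e.toLinearMap.toAddMonoidHom.comp
      (b.comp e.symm.toLinearMap.toAddMonoidHom))^[m] x = e (b^[m] (e.symm x)) := by
    induction m with
    | zero => simp
    | succ m ih =>
      rw [Function.iterate_succ_apply', Function.iterate_succ_apply', ih]
      simp
  rw [key, hX]
  simp

theorem HasXRoot.pi {M : ℕ} {ι : Type*} {N : ι → Type*} [∀ i, AddCommMonoid (N i)]
    [∀ i, Module F[X] (N i)] (h : ∀ i, HasXRoot F M (N i)) : HasXRoot F M (Π i, N i) := by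
  choose b hb hX using h
  refine ⟨AddMonoidHom.pi fun i => (b i).comp (Pi.evalAddMonoidHom N i),
    fun c x => funext fun i => hb i c (x i), fun x => funext fun i => ?_⟩
  rw [Pi.smul_apply, ← hX]
  have key (m : ℕ) : ((AddMonoidHom.pi fun i => (b i).comp (Pi.evalAddMonoidHom N i))^[m] x) i =
      (b i)^[m] (x i) := by
    induction m with
    | zero => rfl
    | succ m ih =>
      rw [Function.iterate_succ_apply', Function.iterate_succ_apply', ← ih]
      rfl
  exact key M

variable [Fintype F]

theorem exists_pow_eq_expand (M : ℕ) [Fact M.Prime] [CharP F M] (f : F[X]) :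
    ∃ g : F[X], g ^ M = expand F M f ∧ (Irreducible f → Irreducible g) ∧
      g.natDegree = f.natDegree := by
  have hbij : Function.Bijective (frobenius F M) :=
    Finite.injective_iff_bijective.1 (frobenius_inj F M)
  let e : F ≃+* F := RingEquiv.ofBijective (frobenius F M) hbij
  refine ⟨f.map e.symm.toRingHom, ?_, fun hf => ?_, natDegree_map _⟩
  · rw [← map_frobenius_expand, ← map_expand, map_map]
    have : (frobenius F M).comp e.symm.toRingHom = RingHom.id F :=
      RingHom.ext fun x => e.apply_symm_apply x
    rw [this, Polynomial.map_id]
  · exact (MulEquiv.irreducible_iff (mapEquiv e.symm)).2 hf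

theorem exists_eq_expand_add_mul {M : ℕ} [Fact M.Prime] [CharP F M] {g : F[X]}
    (hg : Irreducible g) (h : F[X]) : ∃ u r, h = expand F M u + g * r := by
  have : (Ideal.span {g}).IsPrime := (Ideal.span_singleton_prime hg.ne_zero).2 hg.prime
  have := finite_quotient_span hg.ne_zero
  have : CharP (F[X] ⧸ Ideal.span {g}) M :=
    charP_of_injective_algebraMap (algebraMap F (F[X] ⧸ Ideal.span {g})).injective M
  have hs : Function.Surjective (frobenius (F[X] ⧸ Ideal.span {g}) M) :=
    Finite.injective_iff_surjective.1 (frobenius_inj _ M)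
  obtain ⟨y, hy⟩ := hs (Ideal.Quotient.mk _ h)
  obtain ⟨w, rfl⟩ := Ideal.Quotient.mk_surjective y
  rw [frobenius_def, ← map_pow, eq_comm, Ideal.Quotient.eq, Ideal.mem_span_singleton] at hy
  obtain ⟨r, hr⟩ := hy
  refine ⟨w.map (frobenius F M), r, ?_⟩
  rw [← map_expand, map_frobenius_expand, ← hr]
  ring

theorem hasXRoot_pi_quotient {M : ℕ} [Fact M.Prime] [CharP F M] {f : F[X]} (hf : Irreducible f)
    (s : ℕ) : HasXRoot F M (Π a : Fin M, F[X] ⧸ Ideal.span {f ^ ((s + a) / M)}) := by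
  have hM : 0 < M := (Fact.out : M.Prime).pos
  obtain ⟨g, hgf, hg, hdeg⟩ := exists_pow_eq_expand M f
  replace hg := hg hf
  let σ : F[X] →+* F[X] := (expand F M).toRingHom
  let ψ (a : Fin M) : F[X] →ₛₗ[σ] F[X] :=
    { toFun := fun h => g ^ (M - 1 - a) * expand F M h
      map_add' := fun x y => by rw [map_add, mul_add]
      map_smul' := fun x y => by
        simp only [smul_eq_mul, map_mul]
        exact mul_left_comm _ _ _ }
  have hψ (a : Fin M) : Ideal.span {f ^ ((s + a) / M)} ≤
      Submodule.comap (ψ a) (Ideal.span {g ^ s}) := by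
    intro x hx
    obtain ⟨y, rfl⟩ := Ideal.mem_span_singleton.1 hx
    change g ^ (M - 1 - a) * expand F M (f ^ ((s + a) / M) * y) ∈ Ideal.span {g ^ s}
    rw [Ideal.mem_span_singleton, map_mul, map_pow, ← hgf, ← pow_mul, ← mul_assoc, ← pow_add]
    refine (pow_dvd_pow g ?_).mul_right _
    have h1 := Nat.div_add_mod (s + a) M
    have h2 := Nat.mod_lt (s + a) hM
    have h3 := a.2
    omega
  let φ : (Π a : Fin M, F[X] ⧸ Ideal.span {f ^ ((s + a) / M)}) →ₛₗ[σ] F[X] ⧸ Ideal.span {g ^ s} :=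
    ∑ a, (Submodule.mapQ _ _ (ψ a) (hψ a)).comp (LinearMap.proj a)
  have hsingle (a : Fin M) (u : F[X]) :
      φ (Pi.single a (Ideal.Quotient.mk _ u)) =
        Ideal.Quotient.mk _ (g ^ (M - 1 - a) * expand F M u) := by
    simp only [φ, LinearMap.sum_apply, LinearMap.comp_apply, LinearMap.proj_apply]
    rw [Finset.sum_eq_single a]
    · rw [Pi.single_eq_same]
      rfl
    · intro b _ hb
      rw [Pi.single_eq_of_ne hb, map_zero]
    · exact fun h => (h (Finset.mem_univ a)).elim
  have hmem (m : ℕ) (u : F[X]) :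
      Ideal.Quotient.mk (Ideal.span {g ^ s}) (g ^ m * expand F M u) ∈ Set.range φ := by
    have hlt := Nat.mod_lt m hM
    refine ⟨Pi.single ⟨M - 1 - m % M, by omega⟩ (Ideal.Quotient.mk _ (f ^ (m / M) * u)), ?_⟩
    rw [hsingle, map_mul (expand F M), map_pow (expand F M), ← hgf, ← pow_mul, ← mul_assoc, ← pow_add]
    congr 3
    have := Nat.div_add_mod m M
    dsimp only
    omega
  have hmem' (d : ℕ) : ∀ m, s ≤ m + d → ∀ h : F[X],
      Ideal.Quotient.mk (Ideal.span {g ^ s}) (g ^ m * h) ∈ Set.range φ := by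
    induction d with
    | zero =>
      intro m hm h
      refine ⟨0, ?_⟩
      rw [map_zero, eq_comm, Ideal.Quotient.eq_zero_iff_mem, Ideal.mem_span_singleton]
      exact (pow_dvd_pow g hm).mul_right h
    | succ d ih =>
      intro m hm h
      obtain ⟨u, r, rfl⟩ := exists_eq_expand_add_mul (M := M) hg h
      obtain ⟨x, hx⟩ := hmem m u
      obtain ⟨y, hy⟩ := ih (m + 1) (by omega) r
      refine ⟨x + y, ?_⟩
      rw [map_add, hx, hy, ← map_add]
      congr 1
      ring
  have hsurj : Function.Surjective φ := fun y => by
    obtain ⟨x, rfl⟩ := Ideal.Quotient.mk_surjective y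
    simpa using hmem' s 0 (by omega) x
  have hfin (a : Fin M) : Finite (F[X] ⧸ Ideal.span {f ^ ((s + a) / M)}) :=
    finite_quotient_span (pow_ne_zero _ hf.ne_zero)
  have hbij : Function.Bijective φ := by
    refine hsurj.bijective_of_nat_card_le ?_
    rw [Nat.card_pi, natCard_quotient_span (pow_ne_zero _ hg.ne_zero)]
    simp_rw [natCard_quotient_span (pow_ne_zero _ hf.ne_zero), natDegree_pow]
    rw [Finset.prod_pow_eq_pow_sum, ← Finset.sum_mul, sum_range_add_div hM, hdeg]
  exact HasXRoot.of_addEquiv_expand (AddEquiv.ofBijective φ hbij) fun h x => map_smulₛₗ φ h x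

theorem hasXRoot_pi_of_thetaMul_eq {M : ℕ} [Fact M.Prime] [CharP F M] {f : F[X]}
    (hf : Irreducible f) {B : Type*} [Fintype B] (l : B → ℕ) (s : Multiset ℕ)
    (h : thetaMul M s = Finset.univ.val.map l) :
    HasXRoot F M (Π b, F[X] ⧸ Ideal.span {f ^ l b}) := by
  have hM : 0 < M := (Fact.out : M.Prime).pos
  let k : (Σ _ : s.ToType, Fin M) → ℕ := fun x => ((x.1 : ℕ) + x.2) / M
  have hk : (Finset.univ.val.map k).filter (0 < ·) = Finset.univ.val.map l := by
    rw [← h, thetaMul]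
    congr 1
    conv_rhs => rw [← Multiset.map_univ_coe s, Multiset.bind_map]
    have h1 : (Finset.univ : Finset (Σ _ : s.ToType, Fin M)).val =
      (Finset.univ : Finset s.ToType).val.bind fun x =>
        (Finset.univ : Finset (Fin M)).val.map (Sigma.mk x) := rfl
    rw [h1, Multiset.map_bind]
    refine Multiset.bind_congr fun x _ => ?_
    rw [← map_range_add_div hM, Multiset.map_map]
    have h2 : Multiset.range M = (Finset.univ : Finset (Fin M)).val.map (fun a : Fin M => (a : ℕ)) := by
      rw [Fin.univ_val_map]
      exact congrArg _ (List.ext_getElem (by simp) (by simp))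
    rw [h2, Multiset.map_map]
    rfl
  obtain ⟨e⟩ := nonempty_pi_quotient_pow_equiv f hk
  refine HasXRoot.congr ((LinearEquiv.piCurry F[X]
    (fun (x : s.ToType) (a : Fin M) => F[X] ⧸ Ideal.span {f ^ k ⟨x, a⟩})).symm ≪≫ₗ e) ?_
  exact HasXRoot.pi fun x => hasXRoot_pi_quotient hf x

end

section
variable {F : Type*} [Field F]

theorem exists_pow_eq_of_hasXRoot {M n : ℕ} (hM : M ≠ 0) (α : GL (Fin n) F)
    (h : HasXRoot F M (Module.AEval' (Matrix.mulVecLin (α : Matrix (Fin n) (Fin n) F)))) :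
    ∃ β : GL (Fin n) F, β ^ M = α := by
  set φ := Matrix.mulVecLin (α : Matrix (Fin n) (Fin n) F) with hφ
  obtain ⟨b, hb, hX⟩ := h
  let B : (Fin n → F) →ₗ[F] (Fin n → F) :=
    { toFun := fun x => (Module.AEval'.of φ).symm (b (Module.AEval'.of φ x))
      map_add' := fun x y => by simp
      map_smul' := fun c x => by
        rw [map_smul, ← Module.AEval.C_smul, hb, Module.AEval.C_smul, map_smul, RingHom.id_apply] }
  have key (m : ℕ) (x : Fin n → F) :
      (B ^ m) x = (Module.AEval'.of φ).symm (b^[m] (Module.AEval'.of φ x)) := by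
    induction m with
    | zero => simp
    | succ m ih =>
      rw [pow_succ', Module.End.mul_apply, ih, Function.iterate_succ_apply']
      simp [B]
  have hB : B ^ M = φ := LinearMap.ext fun x => by
    rw [key, hX, Module.AEval'.X_smul_of, LinearEquiv.symm_apply_apply]
  have hA : LinearMap.toMatrixAlgEquiv' B ^ M = (α : Matrix (Fin n) (Fin n) F) := by
    rw [← map_pow, hB, hφ]
    exact LinearMap.toMatrixAlgEquiv'_toLinAlgEquiv' _
  have hu : IsUnit (LinearMap.toMatrixAlgEquiv' B) := (isUnit_pow_iff hM).1 (hA ▸ α.isUnit)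
  exact ⟨hu.unit, Units.ext hA⟩

theorem card_torsion_aeval_pow {V : Type*} [AddCommGroup V] [Module F V] {M : ℕ}
    {φ ψ : V →ₗ[F] V} (h : ψ ^ M = φ) {f g : F[X]} (hg : g ^ M = expand F M f) (k : ℕ) :
    Nat.card {v : Module.AEval' φ // f ^ k • v = 0} =
      Nat.card {v : Module.AEval' ψ // g ^ (M * k) • v = 0} := by
  refine Nat.card_congr (((Module.AEval'.of φ).symm.trans
    (Module.AEval'.of ψ)).toEquiv.subtypeEquiv fun v => ?_)
  obtain ⟨x, rfl⟩ := (Module.AEval'.of φ).surjective v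
  have h1 : aeval φ (f ^ k) = aeval ψ (g ^ (M * k)) := by
    rw [pow_mul, hg, map_pow, map_pow, expand_aeval, h]
  rw [LinearEquiv.coe_toEquiv, LinearEquiv.trans_apply, LinearEquiv.symm_apply_apply]
  change f ^ k • Module.AEval.of F V φ x = 0 ↔ g ^ (M * k) • Module.AEval.of F V ψ x = 0
  rw [← Module.AEval.of_aeval_smul, ← Module.AEval.of_aeval_smul, h1,
    LinearEquiv.map_eq_zero_iff, LinearEquiv.map_eq_zero_iff]

variable [Fintype F]

/-- The `g`-power torsion of a finite torsion `F[X]`-module determines a partition. -/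
theorem exists_partition_card_torsion {N : Type*} [AddCommGroup N] [Module F[X] N]
    [Module.Finite F[X] N] (hN : Module.IsTorsion F[X] N) {g : F[X]} (hg : Irreducible g) :
    ∃ s : Multiset ℕ, (∀ p ∈ s, 0 < p) ∧ ∀ k,
      Nat.card {v : N // g ^ k • v = 0} =
        Fintype.card F ^ (g.natDegree * (s.map (min k)).sum) := by
  classical
  obtain ⟨ι, _, p, hp, e, ⟨φ⟩⟩ := Module.equiv_directSum_of_isTorsion hN
  refine ⟨((Finset.univ.filter fun i => Associated (p i) g).val.map e).filter (0 < ·),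
    fun p hp => (Multiset.mem_filter.1 hp).2, fun k => ?_⟩
  rw [sum_map_min_filter_pos, Multiset.map_map, card_torsion_congr φ, card_torsion_directSum]
  change _ = _ ^ (_ * ∑ i ∈ Finset.univ.filter fun i => Associated (p i) g, min k (e i))
  rw [Finset.mul_sum, ← Finset.prod_pow_eq_pow_sum, Finset.prod_filter]
  refine Finset.prod_congr rfl fun i _ => ?_
  split_ifs with h
  · rw [← card_torsion_quotient_pow hg.ne_zero,
      ← Ideal.span_singleton_eq_span_singleton.2 (h.pow_pow (n := e i))]
  · exact card_torsion_quotient_of_isCoprime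
      (((hp i).coprime_iff_not_dvd.2 fun hd => h ((hp i).associated_of_dvd hg hd)).pow)

theorem card_torsion_primary {l : ℕ} {f : Fin l → F[X]} (hinj : Function.Injective f)
    (hf : ∀ i, (f i).Monic ∧ Irreducible (f i)) {c : Fin l → ℕ} (lam : (i : Fin l) → Fin (c i) → ℕ)
    (i : Fin l) (k : ℕ) :
    Nat.card {v : ⨁ i : Fin l, ⨁ j : Fin (c i), F[X] ⧸ Ideal.span {f i ^ lam i j} //
        f i ^ k • v = 0} =
      Fintype.card F ^ ((f i).natDegree * ((Finset.univ.val.map (lam i)).map (min k)).sum) := by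
  rw [card_torsion_directSum, Finset.prod_eq_single i]
  · rw [card_torsion_directSum, Multiset.map_map]
    change _ = _ ^ (_ * ∑ j, min k (lam i j))
    rw [Finset.mul_sum, ← Finset.prod_pow_eq_pow_sum]
    exact Finset.prod_congr rfl fun j _ => card_torsion_quotient_pow (hf i).2.ne_zero _ _
  · intro i' _ hne
    rw [card_torsion_directSum]
    refine Finset.prod_eq_one fun j _ => card_torsion_quotient_of_isCoprime ?_
    refine IsCoprime.pow ((hf i').2.coprime_iff_not_dvd.2 fun hd => hne (hinj ?_))
    exact eq_of_monic_of_associated (hf i').1 (hf i).1 ((hf i').2.associated_of_dvd (hf i).2 hd)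
  · exact fun h => (h (Finset.mem_univ i)).elim

end

/-- Let `M` be a prime, `q` a power of `M`, and `α ∈ GL(n, F_q)` with
`F_q^n`, as an `F_q[X]`-module via `α`, isomorphic to `⊕_i ⊕_j F_q[X]/(f_i^{λ_{i,j}})`,
the `f_i` distinct monic irreducible `≠ X` and each `λ_{f_i}` a partition.  Then `X^M = α`
has a solution in `GL(n, F_q)` iff each partition `λ_{f_i}` lies in the image of `Θ_M` on
the partitions of `|λ_{f_i}|`. -/
theorem statement18 (F : Type*) [Field F] [Fintype F] (M : ℕ) (hM : M.Prime)
    (hq : ∃ e : ℕ, 0 < e ∧ Fintype.card F = M ^ e)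
    (n : ℕ) (α : GL (Fin n) F)
    (l : ℕ) (hl : 0 < l) (f : Fin l → F[X]) (hinj : Function.Injective f)
    (hf : ∀ i, (f i).Monic ∧ Irreducible (f i) ∧ f i ≠ X)
    (c : Fin l → ℕ) (hc : ∀ i, 0 < c i) (lam : (i : Fin l) → Fin (c i) → ℕ)
    (hlam : ∀ i j, 0 < lam i j)
    (hanti : ∀ i, ∀ j k : Fin (c i), j ≤ k → lam i k ≤ lam i j)
    (hiso : Nonempty ((Module.AEval' (Matrix.mulVecLin (α : Matrix (Fin n) (Fin n) F)))
      ≃ₗ[F[X]] ⨁ i : Fin l, ⨁ j : Fin (c i), F[X] ⧸ Ideal.span {f i ^ lam i j})) :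
    (∃ β : GL (Fin n) F, β ^ M = α) ↔
      ∀ i, ∃ s : Multiset ℕ, (∀ p ∈ s, 0 < p) ∧
        s.sum = ∑ j, lam i j ∧
        thetaMul M s = Multiset.map (lam i) Finset.univ.val := by
  obtain ⟨e, he, hcard⟩ := hq
  have : Fact M.Prime := ⟨hM⟩
  have : CharP F M := charP_of_card_eq_prime_pow hcard
  have hf' (i) : (f i).Monic ∧ Irreducible (f i) := ⟨(hf i).1, (hf i).2.1⟩
  obtain ⟨Φ⟩ := hiso
  constructor
  · rintro ⟨β, hβ⟩ i
    set φ := Matrix.mulVecLin (α : Matrix (Fin n) (Fin n) F)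
    set ψ := Matrix.mulVecLin (β : Matrix (Fin n) (Fin n) F)
    have hψ : ψ ^ M = φ := by
      change Matrix.toLinAlgEquiv' (β : Matrix (Fin n) (Fin n) F) ^ M =
        Matrix.toLinAlgEquiv' (α : Matrix (Fin n) (Fin n) F)
      rw [← map_pow, ← hβ, Units.val_pow_eq_pow_val]
    obtain ⟨g, hg, hgirr, hdeg⟩ := exists_pow_eq_expand M (f i)
    replace hgirr := hgirr (hf' i).2
    obtain ⟨s, hs, hcs⟩ := exists_partition_card_torsion
      (Module.AEval.isTorsion_of_finiteDimensional F (Fin n → F) ψ) hgirr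
    have hθ : thetaMul M s = Multiset.map (lam i) Finset.univ.val := by
      refine eq_of_sum_map_min_eq (fun p hp => (Multiset.mem_filter.1 hp).2) (fun p hp => ?_)
        fun k => ?_
      · obtain ⟨j, _, rfl⟩ := Multiset.mem_map.1 hp
        exact hlam i j
      · have h1 := card_torsion_primary hinj hf' lam i k
        rw [← card_torsion_congr Φ, card_torsion_aeval_pow hψ hg] at h1
        have h2 := (hcs (M * k)).symm.trans h1
        rw [hdeg] at h2
        rw [sum_map_min_thetaMul hM.pos]
        exact Nat.eq_of_mul_eq_mul_left (hf' i).2.natDegree_pos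
          (Nat.pow_right_injective Fintype.one_lt_card h2)
    refine ⟨s, hs, ?_, hθ⟩
    rw [← sum_thetaMul hM.pos, hθ]
    rfl
  · intro h
    refine exists_pow_eq_of_hasXRoot hM.ne_zero α (HasXRoot.congr Φ.symm ?_)
    refine HasXRoot.congr (DirectSum.linearEquivFunOnFintype _ _ _).symm (HasXRoot.pi fun i => ?_)
    refine HasXRoot.congr (DirectSum.linearEquivFunOnFintype _ _ _).symm ?_
    obtain ⟨s, _, _, hs⟩ := h i
    exact hasXRoot_pi_of_thetaMul_eq (hf' i).2 (lam i) s hs
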